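/- A linear map φ : C → V₀ satisfies φ(ker ∂) ⊆ range ∂ if and only if there exist γ₁ ∈ End(C) and γ₂ ∈ End(V₀) with φ = γ₂ ∘ ∂ − ∂ ∘ γ₁; that is, the kernel of the map Ψ : Hom(C, V₀) → Hom(ker ∂, coker ∂), Ψ(φ) = π ∘ φ ∘ ι, equals range δ₁. -/

import Mathlib

/-! Characterization of `range δ₁`: a linear map `φ : C → V₀` maps `ker ∂` into
`range ∂` iff `φ = γ₂ ∘ ∂ − ∂ ∘ γ₁` for some `(γ₁, γ₂) ∈ End(C) × End(V₀)`;
i.e. the kernel of `Ψ : Hom(C, V₀) → Hom(ker ∂, coker ∂)`, `Ψ(φ) = π ∘ φ ∘ ι`,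
equals `range δ₁`. -/

variable {k C V₀ : Type*} [Field k] [AddCommGroup C] [Module k C]
  [AddCommGroup V₀] [Module k V₀]

/-- The differential `δ₁ : End(C) × End(V₀) → Hom(C, V₀)`,
`δ₁(γ₁, γ₂) = γ₂ ∘ ∂ − ∂ ∘ γ₁`. -/
def delta1 (d : C →ₗ[k] V₀) :
    (Module.End k C × Module.End k V₀) →ₗ[k] (C →ₗ[k] V₀) where
  toFun γ := γ.2 ∘ₗ d - d ∘ₗ γ.1
  map_add' a b := by
    ext x
    simp [LinearMap.add_comp, LinearMap.comp_add]
    abel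
  map_smul' r a := by
    ext x
    simp [LinearMap.smul_comp, LinearMap.comp_smul, smul_sub]

/-- The map `Ψ : Hom(C, V₀) → Hom(ker ∂, coker ∂)`, `Ψ(φ) = π ∘ φ ∘ ι`. -/
def Psi (d : C →ₗ[k] V₀) :
    (C →ₗ[k] V₀) →ₗ[k] (LinearMap.ker d →ₗ[k] V₀ ⧸ LinearMap.range d) where
  toFun φ := (LinearMap.range d).mkQ ∘ₗ φ ∘ₗ (LinearMap.ker d).subtype
  map_add' a b := by
    simp [LinearMap.add_comp, LinearMap.comp_add]
  map_smul' r a := by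
    simp [LinearMap.smul_comp, LinearMap.comp_smul]

theorem stmt5 (d : C →ₗ[k] V₀) :
    (∀ φ : C →ₗ[k] V₀,
      (∀ x ∈ LinearMap.ker d, φ x ∈ LinearMap.range d) ↔
        ∃ (γ₁ : Module.End k C) (γ₂ : Module.End k V₀),
          φ = γ₂ ∘ₗ d - d ∘ₗ γ₁) ∧
    LinearMap.ker (Psi d) = LinearMap.range (delta1 d) := by
  have h1 : ∀ φ : C →ₗ[k] V₀,
      (∀ x ∈ LinearMap.ker d, φ x ∈ LinearMap.range d) ↔
        ∃ (γ₁ : Module.End k C) (γ₂ : Module.End k V₀),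
          φ = γ₂ ∘ₗ d - d ∘ₗ γ₁ := by
    intro φ
    constructor
    · intro h
      obtain ⟨s, hs⟩ := d.rangeRestrict.exists_rightInverse_of_surjective d.range_rangeRestrict
      obtain ⟨t, ht⟩ := s.exists_extend
      have key : ∀ v ∈ LinearMap.range d, d (t v) = v := by
        intro v hv
        have e1 : t v = s ⟨v, hv⟩ := LinearMap.congr_fun ht ⟨v, hv⟩
        have e2 := congrArg Subtype.val (LinearMap.congr_fun hs ⟨v, hv⟩)
        rw [e1]
        exact e2
      refine ⟨-(t ∘ₗ φ ∘ₗ (LinearMap.id - t ∘ₗ d)), φ ∘ₗ t, ?_⟩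
      ext x
      have hx : d (t (φ (x - t (d x)))) = φ (x - t (d x)) := by
        apply key
        apply h
        rw [LinearMap.mem_ker, map_sub, key _ ⟨x, rfl⟩, sub_self]
      have : φ x = φ (t (d x)) - d (-(t (φ (x - t (d x))))) := by
        rw [map_neg, hx, map_sub]
        abel
      exact this
    · rintro ⟨γ₁, γ₂, rfl⟩ x hx
      rw [LinearMap.mem_ker] at hx
      exact ⟨-γ₁ x, by simp [hx]⟩
  refine ⟨h1, ?_⟩
  ext φ
  have h2 : φ ∈ LinearMap.ker (Psi d) ↔
      ∀ x ∈ LinearMap.ker d, φ x ∈ LinearMap.range d := by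
    rw [LinearMap.mem_ker]
    constructor
    · intro h x hx
      have := LinearMap.congr_fun h ⟨x, hx⟩
      exact (Submodule.Quotient.mk_eq_zero _).1 this
    · intro h
      refine LinearMap.ext fun x => ?_
      exact (Submodule.Quotient.mk_eq_zero _).2 (h x.1 x.2)
  rw [h2, h1]
  constructor
  · rintro ⟨a, b, h⟩
    exact ⟨(a, b), h.symm⟩
  · rintro ⟨⟨a, b⟩, h⟩
    exact ⟨a, b, h.symm⟩
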